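/- arXiv:2509.01064 — 7 statements merged into one kernel-verified Lean document; each statement's English description precedes it below -/
import Mathlib

section
/- Let X be a nonempty finite type, c₀ : X → C₀ a function into a finite type, and P̄₁ a pmf on X. Let W₀* be the induced distribution of c₀ under P̄₁, i.e. W₀*(c*) = Σ_{x : c₀(x) = c*} P̄₁(x), and let P₀^{W₀*} be the microcanonical Bayesian marginal built from W₀*. Then for every pmf W on C₀ vanishing on non-realizable values and satisfying W(c₀(x)) > 0 whenever P̄₁(x) > 0, the Kullback–Leibler divergence is minimized at W₀*: Σ_{x∈X} P̄₁(x)·log(P̄₁(x)/P₀^{W₀*}(x)) ≤ Σ_{x∈X} P̄₁(x)·log(P̄₁(x)/P₀^{W}(x)). -/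
open Finset

/-- Gibbs' inequality for a pmf `p` and a sub-pmf `q` on a finite type. -/
theorem sum_mul_log_le_sum_mul_log_self {ι : Type*} [Fintype ι] (p q : ι → ℝ)
    (hp : ∀ i, 0 ≤ p i) (hq : ∀ i, 0 ≤ q i) (hpq : ∀ i, 0 < p i → 0 < q i)
    (hsum : ∑ i, q i ≤ ∑ i, p i) :
    ∑ i, p i * Real.log (q i) ≤ ∑ i, p i * Real.log (p i) := by
  have hterm : ∀ i, p i * Real.log (q i) ≤ p i * Real.log (p i) + (q i - p i) := by
    intro i
    rcases (hp i).eq_or_lt with h | h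
    · simpa [← h] using hq i
    · have hlog := Real.log_le_sub_one_of_pos (div_pos (hpq i h) h)
      rw [Real.log_div (hpq i h).ne' h.ne'] at hlog
      have hmul := mul_le_mul_of_nonneg_left hlog h.le
      rw [mul_sub, mul_sub, mul_div_cancel₀ _ h.ne'] at hmul
      linarith
  have hle := Finset.sum_le_sum fun i (_ : i ∈ Finset.univ) => hterm i
  rw [Finset.sum_add_distrib, Finset.sum_sub_distrib] at hle
  linarith

/-- For a microcanonical null model with sufficient statistic `c₀`
and alternative marginal `P1` (a pmf on the nonempty finite configuration space `X`),
the prior `W0` on `C₀` given by the induced distribution of `c₀` under `P1` minimizes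
the Kullback–Leibler divergence from `P1` among all priors `W` vanishing on
non-realizable values and positive wherever `P1` is. -/
theorem microcanonical_GRO_prior_minimizes_KL
    {X C₀ : Type*} [Fintype X] [Nonempty X] [Fintype C₀] [DecidableEq C₀]
    (c₀ : X → C₀)
    (P1 : X → ℝ) (hP1_nonneg : ∀ x, 0 ≤ P1 x) (hP1_sum : ∑ x, P1 x = 1)
    (W0 : C₀ → ℝ)
    (hW0 : ∀ b, W0 b = ∑ x ∈ univ.filter (fun x => c₀ x = b), P1 x)
    (P0star : X → ℝ)
    (hP0star : ∀ x, P0star x =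
      W0 (c₀ x) / ((univ.filter (fun y => c₀ y = c₀ x)).card : ℝ))
    (W : C₀ → ℝ) (hW_nonneg : ∀ b, 0 ≤ W b) (hW_sum : ∑ b, W b = 1)
    (hW_vanish : ∀ b, (univ.filter (fun x => c₀ x = b)).card = 0 → W b = 0)
    (hW_pos : ∀ x, 0 < P1 x → 0 < W (c₀ x))
    (P0W : X → ℝ)
    (hP0W : ∀ x, P0W x =
      W (c₀ x) / ((univ.filter (fun y => c₀ y = c₀ x)).card : ℝ)) :
    ∑ x, P1 x * Real.log (P1 x / P0star x) ≤
      ∑ x, P1 x * Real.log (P1 x / P0W x) := by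
  have hfiber : ∀ f : C₀ → ℝ, ∑ x, P1 x * f (c₀ x) = ∑ b, W0 b * f b := by
    intro f
    rw [← sum_fiberwise univ c₀ (fun x => P1 x * f (c₀ x))]
    refine sum_congr rfl fun b _ => ?_
    rw [hW0, sum_mul]
    refine sum_congr rfl fun x hx => ?_
    rw [(mem_filter.mp hx).2]
  have hle_fiber : ∀ x, P1 x ≤ W0 (c₀ x) := fun x => by
    rw [hW0]
    exact single_le_sum (f := P1) (fun y _ => hP1_nonneg y) (by simp)
  have hW0_nonneg : ∀ b, 0 ≤ W0 b := fun b => by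
    rw [hW0]
    exact sum_nonneg fun x _ => hP1_nonneg x
  have hW0_pos : ∀ b, 0 < W0 b → 0 < W b := by
    intro b hb
    rw [hW0] at hb
    obtain ⟨x, hx, hx_pos⟩ := exists_lt_of_sum_lt (f := fun _ => (0 : ℝ)) (by simpa using hb)
    exact (mem_filter.mp hx).2 ▸ hW_pos x hx_pos
  have hW0_sum : ∑ b, W0 b = 1 := by
    simpa [hP1_sum] using (hfiber fun _ => 1).symm
  have hgibbs := sum_mul_log_le_sum_mul_log_self W0 W hW0_nonneg hW_nonneg hW0_pos
    (hW_sum.trans hW0_sum.symm).le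
  rw [← hfiber fun b => Real.log (W b), ← hfiber fun b => Real.log (W0 b)] at hgibbs
  have hdiff : ∀ x, P1 x * Real.log (P1 x / P0W x) - P1 x * Real.log (P1 x / P0star x) =
      P1 x * Real.log (W0 (c₀ x)) - P1 x * Real.log (W (c₀ x)) := by
    intro x
    rcases (hP1_nonneg x).eq_or_lt with h | h
    · simp [← h]
    · have hcard : ((univ.filter (fun y => c₀ y = c₀ x)).card : ℝ) ≠ 0 :=
        Nat.cast_ne_zero.mpr (card_ne_zero_of_mem (a := x) (by simp))
      have hW0x := (h.trans_le (hle_fiber x)).ne'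
      have hWx := (hW_pos x h).ne'
      rw [hP0W, hP0star, Real.log_div h.ne' (div_ne_zero hWx hcard),
        Real.log_div h.ne' (div_ne_zero hW0x hcard), Real.log_div hWx hcard,
        Real.log_div hW0x hcard]
      ring
  have hsum_diff := sum_congr rfl fun x (_ : x ∈ univ) => hdiff x
  rw [sum_sub_distrib, sum_sub_distrib] at hsum_diff
  linarith
end

section
/- Let X be a nonempty finite type, c₁ : X → C₁ and c₀ : X → C₀ functions into finite types, and suppose Condition A holds: there is f : C₁ → C₀ with c₀(x) = f(c₁(x)) for all x ∈ X. Let W₁ be a pmf on C₁ vanishing on non-realizable values, let P̄₁ = P₁^{W₁} be the microcanonical Bayesian marginal built from c₁ and W₁, and let W₀* be the induced distribution of c₀ under P̄₁. Then for every b ∈ C₀: W₀*(b) = Σ_{a ∈ C₁, f(a) = b} W₁(a), i.e. W₀* is the pushforward of W₁ under f. -/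
open Finset

/-- Under Condition A (`c₀ = f ∘ c₁`), the induced distribution `W0`
of the null sufficient statistic `c₀` under the microcanonical Bayesian marginal
`P1 = P₁^{W₁}` is the pushforward of the alternative prior `W₁` under `f`. -/
theorem induced_null_prior_eq_pushforward_under_condition_A
    {X C₁ C₀ : Type*} [Fintype X] [Nonempty X] [Fintype C₁] [Fintype C₀]
    [DecidableEq C₁] [DecidableEq C₀]
    (c₁ : X → C₁) (c₀ : X → C₀)
    (f : C₁ → C₀) (hf : ∀ x, c₀ x = f (c₁ x))
    (W₁ : C₁ → ℝ) (hW₁_nonneg : ∀ a, 0 ≤ W₁ a) (hW₁_sum : ∑ a, W₁ a = 1)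
    (hW₁_vanish : ∀ a, (univ.filter (fun x => c₁ x = a)).card = 0 → W₁ a = 0)
    (P1 : X → ℝ)
    (hP1 : ∀ x, P1 x =
      W₁ (c₁ x) / ((univ.filter (fun y => c₁ y = c₁ x)).card : ℝ))
    (W0 : C₀ → ℝ)
    (hW0 : ∀ b, W0 b = ∑ x ∈ univ.filter (fun x => c₀ x = b), P1 x) :
    ∀ b : C₀, W0 b = ∑ a ∈ univ.filter (fun a => f a = b), W₁ a := by
  intro b
  rw [hW0, ← sum_fiberwise_of_maps_to (g := c₁) (t := univ.filter (fun a => f a = b))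
    (fun x hx => by simpa [hf] using hx)]
  refine sum_congr rfl fun a ha => ?_
  have hfa : f a = b := by simpa using ha
  have hfiber : (univ.filter (fun x => c₀ x = b)).filter (fun x => c₁ x = a) =
      univ.filter (fun x => c₁ x = a) := by
    ext x
    simp only [mem_filter, mem_univ, true_and, and_iff_right_iff_imp]
    rintro rfl
    rw [hf, hfa]
  have hconst : ∀ x ∈ univ.filter (fun x => c₁ x = a),
      P1 x = W₁ a / ((univ.filter (fun y => c₁ y = a)).card : ℝ) := by
    intro x hx
    rw [hP1, (mem_filter.mp hx).2]
  rw [hfiber, sum_congr rfl hconst, sum_const, nsmul_eq_mul]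
  exact mul_div_cancel_of_imp' fun h => hW₁_vanish a (by exact_mod_cast h)
end

section
/- Let X be a nonempty finite type, d ≥ 1, c : X → ℝ^d, and S : X → ℝ with S(x) ≥ 0 for all x. If S is a microcanonical e-variable, i.e. for every realizable value c* (one with Ω_c(c*) > 0) the microcanonical average satisfies (1/Ω_c(c*)) · Σ_{x : c(x) = c*} S(x) ≤ 1, then S is a canonical e-variable: for every θ ∈ ℝ^d, Σ_{x∈X} P_can(x; θ)·S(x) ≤ 1, where P_can(x; θ) = exp(−⟨θ, c(x)⟩)/Z(θ) and Z(θ) = Σ_{x∈X} exp(−⟨θ, c(x)⟩). Moreover, if all the microcanonical averages equal 1, then Σ_{x∈X} P_can(x; θ)·S(x) = 1 for every θ ∈ ℝ^d. -/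
open Finset

theorem sum_comp_mul_eq_sum_image_mul_sum_fiber {X Y : Type*} [Fintype X] [DecidableEq Y]
    (c : X → Y) (f : Y → ℝ) (S : X → ℝ) :
    ∑ x, f (c x) * S x =
      ∑ y ∈ univ.image c, f y * ∑ x ∈ univ.filter (fun x => c x = y), S x := by
  rw [← sum_fiberwise_of_maps_to (t := univ.image c) (g := c)
    fun x hx => mem_image_of_mem c hx]
  refine sum_congr rfl fun y _ => ?_
  rw [mul_sum]
  exact sum_congr rfl fun x hx => by rw [(mem_filter.mp hx).2]

theorem sum_comp_eq_sum_image_mul_card_fiber {X Y : Type*} [Fintype X] [DecidableEq Y]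
    (c : X → Y) (f : Y → ℝ) :
    ∑ x, f (c x) =
      ∑ y ∈ univ.image c, f y * ((univ.filter (fun x => c x = y)).card : ℝ) := by
  simpa using sum_comp_mul_eq_sum_image_mul_sum_fiber c f (fun _ => 1)

theorem card_fiber_pos_of_mem_image {X Y : Type*} [Fintype X] [DecidableEq Y]
    {c : X → Y} {y : Y} (hy : y ∈ univ.image c) :
    0 < (univ.filter (fun x => c x = y)).card := by
  obtain ⟨x, -, hx⟩ := mem_image.mp hy
  exact card_pos.mpr ⟨x, mem_filter.mpr ⟨mem_univ x, hx⟩⟩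

/-- If the average of `S` over each nonempty fiber of `c` is at most one, then so is its average
with respect to nonnegative weights depending only on `c`. -/
theorem sum_comp_mul_le_sum_comp {X Y : Type*} [Fintype X] [DecidableEq Y]
    (c : X → Y) (f : Y → ℝ) (hf : ∀ y, 0 ≤ f y) (S : X → ℝ)
    (h : ∀ y, 0 < (univ.filter (fun x => c x = y)).card →
      (((univ.filter (fun x => c x = y)).card : ℝ))⁻¹ *
        ∑ x ∈ univ.filter (fun x => c x = y), S x ≤ 1) :
    ∑ x, f (c x) * S x ≤ ∑ x, f (c x) := by
  rw [sum_comp_mul_eq_sum_image_mul_sum_fiber, sum_comp_eq_sum_image_mul_card_fiber]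
  refine sum_le_sum fun y hy => mul_le_mul_of_nonneg_left ?_ (hf y)
  have hpos := card_fiber_pos_of_mem_image hy
  simpa using (inv_mul_le_iff₀ (Nat.cast_pos.mpr hpos)).mp (h y hpos)

/-- If the average of `S` over each nonempty fiber of `c` equals one, then so does its average
with respect to weights depending only on `c`. -/
theorem sum_comp_mul_eq_sum_comp {X Y : Type*} [Fintype X] [DecidableEq Y]
    (c : X → Y) (f : Y → ℝ) (S : X → ℝ)
    (h : ∀ y, 0 < (univ.filter (fun x => c x = y)).card →
      (((univ.filter (fun x => c x = y)).card : ℝ))⁻¹ *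
        ∑ x ∈ univ.filter (fun x => c x = y), S x = 1) :
    ∑ x, f (c x) * S x = ∑ x, f (c x) := by
  rw [sum_comp_mul_eq_sum_image_mul_sum_fiber, sum_comp_eq_sum_image_mul_card_fiber]
  refine sum_congr rfl fun y hy => ?_
  have hpos := card_fiber_pos_of_mem_image hy
  have hne : ((univ.filter (fun x => c x = y)).card : ℝ) ≠ 0 := Nat.cast_ne_zero.mpr hpos.ne'
  rw [(inv_mul_eq_one₀ hne).mp (h y hpos)]

/-- A microcanonical e-variable (nonnegative, with microcanonical
average at most one at every realizable value of the sufficient statistic `c`) is also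
a canonical e-variable for the exponential family with sufficient statistic `c`;
moreover, if all microcanonical averages are exactly one, then the canonical
expectation is exactly one for every parameter `θ`. -/
theorem microcanonical_evariable_is_canonical_evariable
    {X : Type*} [Fintype X] [Nonempty X] {d : ℕ} (hd : 1 ≤ d)
    (c : X → (Fin d → ℝ)) (S : X → ℝ) (hS_nonneg : ∀ x, 0 ≤ S x)
    (Z : (Fin d → ℝ) → ℝ)
    (hZ : ∀ θ, Z θ = ∑ x : X, Real.exp (-(∑ i, θ i * c x i)))
    (Pcan : (Fin d → ℝ) → X → ℝ)
    (hPcan : ∀ θ x, Pcan θ x = Real.exp (-(∑ i, θ i * c x i)) / Z θ)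
    (hmic : ∀ cstar : Fin d → ℝ, 0 < (univ.filter (fun x => c x = cstar)).card →
      (((univ.filter (fun x => c x = cstar)).card : ℝ))⁻¹ *
        ∑ x ∈ univ.filter (fun x => c x = cstar), S x ≤ 1) :
    (∀ θ : Fin d → ℝ, ∑ x, Pcan θ x * S x ≤ 1) ∧
    ((∀ cstar : Fin d → ℝ, 0 < (univ.filter (fun x => c x = cstar)).card →
        (((univ.filter (fun x => c x = cstar)).card : ℝ))⁻¹ *
          ∑ x ∈ univ.filter (fun x => c x = cstar), S x = 1) →
      ∀ θ : Fin d → ℝ, ∑ x, Pcan θ x * S x = 1) := by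
  have hZpos : ∀ θ, 0 < Z θ := fun θ => by
    rw [hZ]
    exact sum_pos (fun x _ => Real.exp_pos _) univ_nonempty
  have hsum : ∀ θ, ∑ x, Pcan θ x * S x =
      (∑ x, Real.exp (-(∑ i, θ i * c x i)) * S x) / Z θ := fun θ => by
    simp only [hPcan, sum_div, div_mul_eq_mul_div]
  refine ⟨fun θ => ?_, fun heq θ => ?_⟩
  · rw [hsum, div_le_one (hZpos θ), hZ]
    exact sum_comp_mul_le_sum_comp c (fun y => Real.exp (-(∑ i, θ i * y i)))
      (fun y => (Real.exp_pos _).le) S hmic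
  · rw [hsum, div_eq_one_iff_eq (hZpos θ).ne', hZ]
    exact sum_comp_mul_eq_sum_comp c (fun y => Real.exp (-(∑ i, θ i * y i))) S heq
end

section
/- Let X be a nonempty finite type, d ≥ 1, c₀ : X → ℝ^d, and P̄₁ a pmf on X with P̄₁(x) > 0 for all x ∈ X. Let W₀* be the induced distribution of c₀ under P̄₁ (so W₀*(c₀(x)) ≥ P̄₁(x) > 0 for all x), and let P₀^{W₀*}(x) = W₀*(c₀(x))/Ω_{c₀}(c₀(x)) be the microcanonical Bayesian marginal. Then the microcanonical GRO e-variable S(x) = P̄₁(x)/P₀^{W₀*}(x) has expectation exactly one under every canonical null distribution: for every θ ∈ ℝ^d, Σ_{x∈X} [exp(−⟨θ, c₀(x)⟩)/Z(θ)] · S(x) = 1, where Z(θ) = Σ_{x∈X} exp(−⟨θ, c₀(x)⟩). In particular S is a valid e-variable for the canonical null model built from c₀. -/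
open Finset

/-- Weighting a function of `c` by the ratio of a positive function `p` to its average over
the fibers of `c` does not change its sum. -/
theorem sum_comp_mul_div_fiber_average {X B : Type*} [Fintype X] [DecidableEq B]
    (c : X → B) (p : X → ℝ) (hp : ∀ x, 0 < p x) (g : B → ℝ) :
    ∑ x, g (c x) * (p x / ((∑ y ∈ univ.filter (fun y => c y = c x), p y) /
      ((univ.filter (fun y => c y = c x)).card : ℝ))) = ∑ x, g (c x) := by
  have hmaps : ∀ x ∈ (univ : Finset X), c x ∈ univ.image c :=
    fun x hx => mem_image_of_mem c hx
  rw [← sum_fiberwise_of_maps_to hmaps, ← sum_fiberwise_of_maps_to hmaps]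
  refine sum_congr rfl fun b hb => ?_
  obtain ⟨x₀, -, rfl⟩ := mem_image.mp hb
  have hW : 0 < ∑ y ∈ univ.filter (fun y => c y = c x₀), p y :=
    sum_pos (fun y _ => hp y) ⟨x₀, by simp⟩
  calc
    _ = ∑ x ∈ univ.filter (fun x => c x = c x₀), g (c x₀) *
        (p x / ((∑ y ∈ univ.filter (fun y => c y = c x₀), p y) /
          ((univ.filter (fun y => c y = c x₀)).card : ℝ))) :=
      sum_congr rfl fun x hx => by rw [(mem_filter.mp hx).2]
    _ = ∑ _x ∈ univ.filter (fun x => c x = c x₀), g (c x₀) := by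
      rw [← mul_sum, ← sum_div, div_div_cancel₀ hW.ne', sum_const, nsmul_eq_mul, mul_comm]
    _ = _ := sum_congr rfl fun x hx => by rw [(mem_filter.mp hx).2]

/-- For a strictly positive pmf `P1` on the nonempty finite space `X`,
the microcanonical GRO e-variable `S = P1 / P₀^{W₀*}` (with `W₀*` the induced
distribution of `c₀` under `P1`) has expectation exactly one under every canonical
null distribution with sufficient statistic `c₀`; in particular it is a valid
e-variable for the canonical null model. -/
theorem microcanonical_GRO_evariable_canonical_expectation_one
    {X : Type*} [Fintype X] [Nonempty X] {d : ℕ} (hd : 1 ≤ d)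
    (c₀ : X → (Fin d → ℝ))
    (P1 : X → ℝ) (hP1_pos : ∀ x, 0 < P1 x) (hP1_sum : ∑ x, P1 x = 1)
    (W0 : (Fin d → ℝ) → ℝ)
    (hW0 : ∀ b, W0 b = ∑ x ∈ univ.filter (fun x => c₀ x = b), P1 x)
    (P0star : X → ℝ)
    (hP0star : ∀ x, P0star x =
      W0 (c₀ x) / ((univ.filter (fun y => c₀ y = c₀ x)).card : ℝ))
    (S : X → ℝ) (hS : ∀ x, S x = P1 x / P0star x)
    (Z : (Fin d → ℝ) → ℝ)
    (hZ : ∀ θ, Z θ = ∑ x : X, Real.exp (-(∑ i, θ i * c₀ x i))) :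
    (∀ θ : Fin d → ℝ,
      ∑ x, (Real.exp (-(∑ i, θ i * c₀ x i)) / Z θ) * S x = 1) ∧
    (∀ θ : Fin d → ℝ,
      ∑ x, (Real.exp (-(∑ i, θ i * c₀ x i)) / Z θ) * S x ≤ 1) := by
  have expectation_one : ∀ θ : Fin d → ℝ,
      ∑ x, (Real.exp (-(∑ i, θ i * c₀ x i)) / Z θ) * S x = 1 := by
    intro θ
    have hZ_pos : 0 < Z θ := by
      rw [hZ]
      exact sum_pos (fun x _ => Real.exp_pos _) univ_nonempty
    simp only [hS, hP0star, hW0]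
    rw [sum_comp_mul_div_fiber_average c₀ P1 hP1_pos
      (fun b => Real.exp (-(∑ i, θ i * b i)) / Z θ), ← sum_div, ← hZ, div_self hZ_pos.ne']
  exact ⟨expectation_one, fun θ => (expectation_one θ).le⟩
end

section
/- Let X be a nonempty finite type, d ≥ 1, c : X → ℝ^d, and let w be a Borel probability measure on ℝ^d. Define the canonical Bayesian marginal P^w(x) = ∫_{ℝ^d} [exp(−⟨θ, c(x)⟩)/Z(θ)] dw(θ), where Z(θ) = Σ_{y∈X} exp(−⟨θ, c(y)⟩) (the integrand is continuous in θ and takes values in (0,1], so the integral exists). Then: (i) P^w(x) > 0 for every x ∈ X; and (ii) consequently, if W is a pmf on ℝ^d (vanishing on non-realizable values of c) with W(c(x₀)) = 0 for some x₀ ∈ X, then the microcanonical Bayesian marginal P^W, which satisfies P^W(x₀) = 0, is not equal to P^w for any Borel probability measure w on ℝ^d. -/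
open Finset MeasureTheory

/-- The integral of a continuous function with values in `(0, 1]` against a probability measure
is positive. -/
theorem integral_pos_of_continuous_of_pos_of_le_one {E : Type*} [TopologicalSpace E]
    [MeasurableSpace E] [OpensMeasurableSpace E] (w : Measure E)
    [IsProbabilityMeasure w] {f : E → ℝ} (hf : Continuous f) (hpos : ∀ θ, 0 < f θ)
    (hle : ∀ θ, f θ ≤ 1) : 0 < ∫ θ, f θ ∂w := by
  have hint : Integrable f w := by
    refine Integrable.of_bound hf.aestronglyMeasurable 1 (ae_of_all _ fun θ => ?_)
    rw [Real.norm_of_nonneg (hpos θ).le]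
    exact hle θ
  rw [integral_pos_iff_support_of_nonneg (fun θ => (hpos θ).le) hint,
    Function.support_eq_univ fun θ => (hpos θ).ne', measure_univ]
  exact one_pos

/-- (i) The canonical Bayesian marginal `P^w` built from any Borel
probability measure `w` on the parameter space is strictly positive on the whole
(nonempty, finite) configuration space; (ii) consequently, a microcanonical Bayesian
marginal `P^W` whose prior `W` vanishes at some realized value `c x₀` (so that
`P^W x₀ = 0`) is not equal to `P^w` for any Borel probability measure `w`. -/
theorem canonical_marginal_positive_and_micro_marginal_not_canonical
    {X : Type*} [Fintype X] [Nonempty X] {d : ℕ} (hd : 1 ≤ d)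
    (c : X → (Fin d → ℝ))
    (Z : (Fin d → ℝ) → ℝ)
    (hZ : ∀ θ, Z θ = ∑ y : X, Real.exp (-(∑ i, θ i * c y i)))
    (Pw : Measure (Fin d → ℝ) → X → ℝ)
    (hPw : ∀ w x, Pw w x = ∫ θ, (Real.exp (-(∑ i, θ i * c x i)) / Z θ) ∂w) :
    (∀ w : Measure (Fin d → ℝ), IsProbabilityMeasure w → ∀ x, 0 < Pw w x) ∧
    (∀ W : (Fin d → ℝ) → ℝ, (∀ b, 0 ≤ W b) →
      (∀ b, (univ.filter (fun x => c x = b)).card = 0 → W b = 0) →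
      (∑' b, W b = 1) →
      ∀ PW : X → ℝ,
        (∀ x, PW x = W (c x) / ((univ.filter (fun y => c y = c x)).card : ℝ)) →
        ∀ x₀ : X, W (c x₀) = 0 →
          PW x₀ = 0 ∧
          ∀ w : Measure (Fin d → ℝ), IsProbabilityMeasure w → PW ≠ Pw w) := by
  have hpos : ∀ w : Measure (Fin d → ℝ), IsProbabilityMeasure w → ∀ x, 0 < Pw w x := by
    intro w hw x
    have hZpos : ∀ θ, 0 < Z θ := fun θ => by
      rw [hZ]
      exact sum_pos (fun y _ => Real.exp_pos _) univ_nonempty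
    have hZcont : Continuous Z := by
      rw [funext hZ]
      fun_prop
    rw [hPw]
    refine integral_pos_of_continuous_of_pos_of_le_one w
      (Continuous.div (by fun_prop) hZcont fun θ => (hZpos θ).ne')
      (fun θ => div_pos (Real.exp_pos _) (hZpos θ)) fun θ => ?_
    rw [div_le_one (hZpos θ), hZ]
    exact single_le_sum (f := fun y => Real.exp (-(∑ i, θ i * c y i)))
      (fun y _ => (Real.exp_pos _).le) (mem_univ x)
  refine ⟨hpos, fun W _ _ _ PW hPW x₀ hx₀ => ?_⟩
  have hzero : PW x₀ = 0 := by rw [hPW, hx₀, zero_div]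
  exact ⟨hzero, fun w hw h => (hpos w hw x₀).ne' (by rw [← h, hzero])⟩
end

section
/- Let X be a nonempty finite type, c₁ : X → C₁ and c₀ : X → C₀ functions into finite types. Let W₁ be a pmf on C₁ vanishing on non-realizable values, P̄₁ = P₁^{W₁} the microcanonical Bayesian marginal built from c₁ and W₁, and W₀* the induced distribution of c₀ under P̄₁. Fix c̄₁ ∈ C₁ with Ω_{c₁}(c̄₁) > 0 and W₁(c̄₁) > 0, let P₁ be the microcanonical distribution with parameter c̄₁, and let W̃₀ be the induced distribution of c₀ under P₁. Then the regret of the Bayes-factor e-variable with numerator P̄₁ is bounded by the redundancy of P̄₁ at c̄₁: Σ_x P₁(x)·log(P₁(x)/P₀^{W̃₀}(x)) − Σ_x P₁(x)·log(P̄₁(x)/P₀^{W₀*}(x)) ≤ Σ_x P₁(x)·log(P₁(x)/P̄₁(x)), where P₀^{W̃₀} and P₀^{W₀*} are the microcanonical Bayesian marginals built from c₀ with priors W̃₀ and W₀* respectively. -/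
open Finset

/-- A microcanonical Bayesian marginal has the same total mass as its prior. -/
theorem sum_div_card_fiber {X C : Type*} [Fintype X] [Fintype C] [DecidableEq C]
    (c : X → C) (W : C → ℝ)
    (hW : ∀ a, (univ.filter (fun x => c x = a)).card = 0 → W a = 0) :
    ∑ x, W (c x) / ((univ.filter (fun y => c y = c x)).card : ℝ) = ∑ a, W a := by
  rw [← sum_fiberwise univ c]
  refine sum_congr rfl fun a _ => ?_
  have h : ∀ x ∈ univ.filter (fun x => c x = a),
      W (c x) / ((univ.filter (fun y => c y = c x)).card : ℝ) =
        W a / ((univ.filter (fun y => c y = a)).card : ℝ) := by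
    intro x hx
    rw [(mem_filter.1 hx).2]
  rw [sum_congr rfl h, sum_const, nsmul_eq_mul]
  by_cases h₀ : (univ.filter (fun x => c x = a)).card = 0
  · simp [hW a h₀]
  · have : ((univ.filter (fun x => c x = a)).card : ℝ) ≠ 0 := Nat.cast_ne_zero.2 h₀
    field_simp

/-- The expectation of a likelihood ratio of pushforwards is at most the mass of the numerator. -/
theorem sum_mul_fiber_ratio_le {X C : Type*} [Fintype X] [Fintype C] [DecidableEq C]
    (c : X → C) (P Q : X → ℝ) (hQ : ∀ x, 0 ≤ Q x) :
    ∑ x, P x * ((∑ y ∈ univ.filter (fun y => c y = c x), Q y) /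
      ∑ y ∈ univ.filter (fun y => c y = c x), P y) ≤ ∑ x, Q x := by
  rw [← sum_fiberwise univ c, ← sum_fiberwise univ c Q]
  refine sum_le_sum fun b _ => ?_
  have h : ∀ x ∈ univ.filter (fun x => c x = b),
      P x * ((∑ y ∈ univ.filter (fun y => c y = c x), Q y) /
        ∑ y ∈ univ.filter (fun y => c y = c x), P y) =
      P x * ((∑ y ∈ univ.filter (fun y => c y = b), Q y) /
        ∑ y ∈ univ.filter (fun y => c y = b), P y) := by
    intro x hx
    rw [(mem_filter.1 hx).2]
  rw [sum_congr rfl h, ← sum_mul]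
  by_cases h₀ : ∑ y ∈ univ.filter (fun y => c y = b), P y = 0
  · simpa [h₀] using sum_nonneg fun y _ => hQ y
  · rw [mul_div_cancel₀ _ h₀]

/-- The regret of the Bayes-factor e-variable with numerator the
microcanonical Bayesian marginal `P̄₁ = P₁^{W₁}`, evaluated at a microcanonical
alternative `P₁` with parameter `c̄₁`, is bounded by the redundancy of `P̄₁` at `c̄₁`.
Here `P₀^{W̃₀}` and `P₀^{W₀*}` are the microcanonical Bayesian marginals for the null
statistic `c₀` with priors induced by `P₁` and by `P̄₁`, respectively. -/
theorem regret_le_redundancy_microcanonical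
    {X C₁ C₀ : Type*} [Fintype X] [Nonempty X] [Fintype C₁] [Fintype C₀]
    [DecidableEq C₁] [DecidableEq C₀]
    (c₁ : X → C₁) (c₀ : X → C₀)
    (W₁ : C₁ → ℝ) (hW₁_nonneg : ∀ a, 0 ≤ W₁ a) (hW₁_sum : ∑ a, W₁ a = 1)
    (hW₁_vanish : ∀ a, (univ.filter (fun x => c₁ x = a)).card = 0 → W₁ a = 0)
    (Pbar1 : X → ℝ)
    (hPbar1 : ∀ x, Pbar1 x =
      W₁ (c₁ x) / ((univ.filter (fun y => c₁ y = c₁ x)).card : ℝ))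
    (W0star : C₀ → ℝ)
    (hW0star : ∀ b, W0star b = ∑ x ∈ univ.filter (fun x => c₀ x = b), Pbar1 x)
    (cbar₁ : C₁) (hcbar₁_real : 0 < (univ.filter (fun x => c₁ x = cbar₁)).card)
    (hcbar₁_pos : 0 < W₁ cbar₁)
    (P1 : X → ℝ)
    (hP1 : ∀ x, P1 x = if c₁ x = cbar₁ then
      (((univ.filter (fun y => c₁ y = cbar₁)).card : ℝ))⁻¹ else 0)
    (Wtilde0 : C₀ → ℝ)
    (hWtilde0 : ∀ b, Wtilde0 b = ∑ x ∈ univ.filter (fun x => c₀ x = b), P1 x)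
    (P0tilde : X → ℝ)
    (hP0tilde : ∀ x, P0tilde x =
      Wtilde0 (c₀ x) / ((univ.filter (fun y => c₀ y = c₀ x)).card : ℝ))
    (P0star : X → ℝ)
    (hP0star : ∀ x, P0star x =
      W0star (c₀ x) / ((univ.filter (fun y => c₀ y = c₀ x)).card : ℝ)) :
    (∑ x, P1 x * Real.log (P1 x / P0tilde x)) -
        (∑ x, P1 x * Real.log (Pbar1 x / P0star x)) ≤
      ∑ x, P1 x * Real.log (P1 x / Pbar1 x) := by
  have hcard : ∀ x, (0 : ℝ) < ((univ.filter (fun y => c₀ y = c₀ x)).card : ℝ) := fun x =>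
    Nat.cast_pos.2 (card_pos.2 ⟨x, by simp⟩)
  have hN : (0 : ℝ) < ((univ.filter (fun x => c₁ x = cbar₁)).card : ℝ) :=
    Nat.cast_pos.2 hcbar₁_real
  have hP1_nonneg : ∀ x, 0 ≤ P1 x := by
    intro x
    rw [hP1]
    split_ifs <;> positivity
  have hPbar1_nonneg : ∀ x, 0 ≤ Pbar1 x := by
    intro x
    rw [hPbar1]
    exact div_nonneg (hW₁_nonneg _) (Nat.cast_nonneg _)
  have hPbar1_sum : ∑ x, Pbar1 x = 1 := by
    simp_rw [hPbar1]
    rw [sum_div_card_fiber c₁ W₁ hW₁_vanish, hW₁_sum]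
  have hP1_sum : ∑ x, P1 x = 1 := by
    simp_rw [hP1]
    rw [← sum_filter, sum_const, nsmul_eq_mul, mul_inv_cancel₀ hN.ne']
  have hterm : ∀ x, P1 x * Real.log (P1 x / P0tilde x) - P1 x * Real.log (Pbar1 x / P0star x) -
      P1 x * Real.log (P1 x / Pbar1 x) ≤
        P1 x * (W0star (c₀ x) / Wtilde0 (c₀ x)) - P1 x := by
    intro x
    by_cases hx : c₁ x = cbar₁
    · have hP : 0 < P1 x := by
        rw [hP1, if_pos hx]
        positivity
      have hPb : 0 < Pbar1 x := by
        rw [hPbar1, hx]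
        positivity
      have hWt : 0 < Wtilde0 (c₀ x) := by
        rw [hWtilde0]
        exact sum_pos' (fun y _ => hP1_nonneg y) ⟨x, by simp, hP⟩
      have hWs : 0 < W0star (c₀ x) := by
        rw [hW0star]
        exact sum_pos' (fun y _ => hPbar1_nonneg y) ⟨x, by simp, hPb⟩
      have hc := hcard x
      have hlog := Real.log_le_sub_one_of_pos (div_pos hWs hWt)
      rw [Real.log_div hWs.ne' hWt.ne'] at hlog
      rw [hP0tilde, hP0star, Real.log_div hP.ne' (div_pos hWt hc).ne',
        Real.log_div hPb.ne' (div_pos hWs hc).ne', Real.log_div hP.ne' hPb.ne',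
        Real.log_div hWt.ne' hc.ne', Real.log_div hWs.ne' hc.ne']
      linarith [mul_le_mul_of_nonneg_left hlog hP.le]
    · simp [hP1 x, hx]
  have hratio : ∑ x, P1 x * (W0star (c₀ x) / Wtilde0 (c₀ x)) ≤ ∑ x, Pbar1 x := by
    simp_rw [hW0star, hWtilde0]
    exact sum_mul_fiber_ratio_le c₀ P1 Pbar1 hPbar1_nonneg
  have hsum := sum_le_sum fun x (_ : x ∈ univ) => hterm x
  simp only [sum_sub_distrib] at hsum
  linarith
end

section
/- Let X be a nonempty finite type, c₀ : X → C₀ a function into a finite type, and P̄₁ a pmf on X. Let W₀* be the induced distribution of c₀ under P̄₁ and P₀^{W₀*} the corresponding microcanonical Bayesian marginal. Let Q be any pmf on X with Q(x) > 0 for all x that is constant on the level sets of c₀, and let Q^{c₀} be the induced distribution of c₀ under Q. Then the e-power gap r = Σ_x P̄₁(x)·[log(P̄₁(x)/Q(x)) − log(P̄₁(x)/P₀^{W₀*}(x))] satisfies r = Σ_x P̄₁(x)·log(W₀*(c₀(x))/Q^{c₀}(c₀(x))) = D_KL(W₀* ‖ Q^{c₀}) = Σ_{b∈C₀} W₀*(b)·log(W₀*(b)/Q^{c₀}(b)),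 and in particular r ≥ 0. -/
open Finset

/-- The Gibbs inequality for nonnegative functions of equal total mass on a finite type. -/
theorem sum_mul_log_div_nonneg {ι : Type*} [Fintype ι] (w q : ι → ℝ)
    (hw : ∀ b, 0 ≤ w b) (hq : ∀ b, 0 ≤ q b) (hac : ∀ b, q b = 0 → w b = 0)
    (hsum : ∑ b, w b = ∑ b, q b) :
    0 ≤ ∑ b, w b * Real.log (w b / q b) := by
  have hterm : ∀ b, w b - q b ≤ w b * Real.log (w b / q b) := by
    intro b
    rcases (hw b).eq_or_lt with h0 | hwb
    · rw [← h0]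
      simpa using hq b
    have hqb : 0 < q b := (hq b).lt_of_ne fun h => hwb.ne' (hac b h.symm)
    have hlog := Real.one_sub_inv_le_log_of_pos (div_pos hwb hqb)
    calc w b - q b = w b * (1 - (w b / q b)⁻¹) := by field_simp
      _ ≤ w b * Real.log (w b / q b) := mul_le_mul_of_nonneg_left hlog hwb.le
  calc (0 : ℝ) = ∑ b, (w b - q b) := by rw [Finset.sum_sub_distrib, hsum, sub_self]
    _ ≤ _ := Finset.sum_le_sum fun b _ => hterm b

/-- The e-power gap `r` between the pseudo e-variable (with a strictly
positive denominator `Q` constant on the level sets of `c₀`) and the microcanonical GRO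
e-variable equals the Kullback–Leibler divergence between the induced distributions
`W₀*` and `Q^{c₀}` of the null sufficient statistic; in particular `r ≥ 0`. -/
theorem epower_gap_eq_KL_of_induced_priors
    {X C₀ : Type*} [Fintype X] [Nonempty X] [Fintype C₀] [DecidableEq C₀]
    (c₀ : X → C₀)
    (Pbar1 : X → ℝ) (hPbar1_nonneg : ∀ x, 0 ≤ Pbar1 x) (hPbar1_sum : ∑ x, Pbar1 x = 1)
    (W0star : C₀ → ℝ)
    (hW0star : ∀ b, W0star b = ∑ x ∈ univ.filter (fun x => c₀ x = b), Pbar1 x)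
    (P0star : X → ℝ)
    (hP0star : ∀ x, P0star x =
      W0star (c₀ x) / ((univ.filter (fun y => c₀ y = c₀ x)).card : ℝ))
    (Q : X → ℝ) (hQ_pos : ∀ x, 0 < Q x) (hQ_sum : ∑ x, Q x = 1)
    (hQ_const : ∀ x y, c₀ x = c₀ y → Q x = Q y)
    (Qc₀ : C₀ → ℝ)
    (hQc₀ : ∀ b, Qc₀ b = ∑ x ∈ univ.filter (fun x => c₀ x = b), Q x)
    (r : ℝ)
    (hr : r = ∑ x, Pbar1 x *
      (Real.log (Pbar1 x / Q x) - Real.log (Pbar1 x / P0star x))) :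
    r = ∑ x, Pbar1 x * Real.log (W0star (c₀ x) / Qc₀ (c₀ x)) ∧
    r = ∑ b, W0star b * Real.log (W0star b / Qc₀ b) ∧
    0 ≤ r := by
  have hW_nonneg : ∀ b, 0 ≤ W0star b := fun b => by
    rw [hW0star]
    exact sum_nonneg fun x _ => hPbar1_nonneg x
  have hQc_nonneg : ∀ b, 0 ≤ Qc₀ b := fun b => by
    rw [hQc₀]
    exact sum_nonneg fun x _ => (hQ_pos x).le
  have hac : ∀ b, Qc₀ b = 0 → W0star b = 0 := by
    intro b hb
    rw [hQc₀, sum_eq_zero_iff_of_nonneg fun x _ => (hQ_pos x).le] at hb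
    rw [hW0star]
    exact sum_eq_zero fun x hx => absurd (hb x hx) (hQ_pos x).ne'
  have hmass : ∑ b, W0star b = ∑ b, Qc₀ b := by
    simp only [hW0star, hQc₀]
    rw [sum_fiberwise, sum_fiberwise, hPbar1_sum, hQ_sum]
  have hQc_eq : ∀ x, Qc₀ (c₀ x) = (univ.filter fun y => c₀ y = c₀ x).card * Q x := by
    intro x
    rw [hQc₀, sum_congr rfl fun y hy => hQ_const y x (mem_filter.1 hy).2, sum_const,
      nsmul_eq_mul]
  have hpoint : r = ∑ x, Pbar1 x * Real.log (W0star (c₀ x) / Qc₀ (c₀ x)) := by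
    rw [hr]
    refine sum_congr rfl fun x _ => ?_
    rcases (hPbar1_nonneg x).eq_or_lt with h0 | hP
    · simp [← h0]
    have hW : 0 < W0star (c₀ x) := by
      rw [hW0star]
      exact sum_pos' (fun y _ => hPbar1_nonneg y) ⟨x, by simp, hP⟩
    have hcard : 0 < ((univ.filter fun y => c₀ y = c₀ x).card : ℝ) :=
      Nat.cast_pos.2 (card_pos.2 ⟨x, by simp⟩)
    have hQx := hQ_pos x
    rw [hP0star, hQc_eq, ← Real.log_div (by positivity) (by positivity)]
    congr 2
    field_simp
  have hfiber : ∑ x, Pbar1 x * Real.log (W0star (c₀ x) / Qc₀ (c₀ x)) =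
      ∑ b, W0star b * Real.log (W0star b / Qc₀ b) := by
    rw [← sum_fiberwise univ c₀]
    refine sum_congr rfl fun b _ => ?_
    conv_rhs => rw [hW0star b, sum_mul, ← hW0star b]
    exact sum_congr rfl fun x hx => by rw [(mem_filter.1 hx).2]
  refine ⟨hpoint, hpoint.trans hfiber, ?_⟩
  rw [hpoint, hfiber]
  exact sum_mul_log_div_nonneg W0star Qc₀ hW_nonneg hQc_nonneg hac hmass
end
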